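/- arXiv:1910.09314 — 5 statements merged into one kernel-verified Lean document; each statement's English description precedes it below -/
import Mathlib

section
/- For every p ∈ 𝒵 and every y ∈ ℝ^M, the Fenchel coupling satisfies F(p,y) ≥ (K/2)‖Φ(y) − p‖². -/
open scoped Matrix

/-- **Fenchel coupling lower bound.**
Let 𝒵 ⊆ ℝ^M be nonempty compact convex, ‖·‖ (= `nrm`) a norm on ℝ^M, K > 0, ψ a continuous
K-strongly convex regularizer on 𝒵, Φ the induced mirror map (argmax of x ↦ ⟨y,x⟩ − ψ(x) on 𝒵)
and F(p,y) = ψ(p) + max_{x∈𝒵}(⟨y,x⟩ − ψ(x)) − ⟨y,p⟩ the Fenchel coupling.  Then for every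
p ∈ 𝒵 and y ∈ ℝ^M: F(p,y) ≥ (K/2)‖Φ(y) − p‖². -/
theorem stmt1 {M : ℕ} (Z : Set (Fin M → ℝ)) (hZne : Z.Nonempty)
    (hZcomp : IsCompact Z) (hZconv : Convex ℝ Z)
    (nrm : (Fin M → ℝ) → ℝ)
    (hnrm0 : ∀ x, nrm x = 0 ↔ x = 0)
    (hnrmS : ∀ (c : ℝ) x, nrm (c • x) = |c| * nrm x)
    (hnrmT : ∀ x y, nrm (x + y) ≤ nrm x + nrm y)
    (K : ℝ) (hK : 0 < K)
    (ψ : (Fin M → ℝ) → ℝ) (hψcont : ContinuousOn ψ Z)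
    (hψsc : ∀ x ∈ Z, ∀ y ∈ Z, ∀ t ∈ Set.Icc (0 : ℝ) 1,
      ψ (t • x + (1 - t) • y) ≤ t * ψ x + (1 - t) * ψ y - K / 2 * t * (1 - t) * nrm (x - y) ^ 2)
    (Φ : (Fin M → ℝ) → (Fin M → ℝ))
    (hΦmem : ∀ y, Φ y ∈ Z)
    (hΦmax : ∀ y, IsMaxOn (fun x => y ⬝ᵥ x - ψ x) Z (Φ y))
    (F : (Fin M → ℝ) → (Fin M → ℝ) → ℝ)
    (hF : ∀ p y, F p y = ψ p + (y ⬝ᵥ Φ y - ψ (Φ y)) - y ⬝ᵥ p) :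
    ∀ p ∈ Z, ∀ y : Fin M → ℝ, F p y ≥ K / 2 * nrm (Φ y - p) ^ 2 := by
  intro p hp y
  have hsymm : nrm (p - Φ y) = nrm (Φ y - p) := by
    simpa using hnrmS (-1) (Φ y - p)
  have hsegment : ∀ t : ℝ, 0 < t → t ≤ 1 →
      (1 - t) * (K / 2 * nrm (Φ y - p) ^ 2) ≤ F p y := by
    intro t ht0 ht1
    have hconv := hψsc p hp (Φ y) (hΦmem y) t ⟨ht0.le, ht1⟩
    have hmax : y ⬝ᵥ (t • p + (1 - t) • Φ y) - ψ (t • p + (1 - t) • Φ y)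
        ≤ y ⬝ᵥ Φ y - ψ (Φ y) :=
      hΦmax y (hZconv hp (hΦmem y) ht0.le (sub_nonneg.2 ht1) (by ring))
    rw [dotProduct_add, dotProduct_smul, dotProduct_smul, smul_eq_mul, smul_eq_mul] at hmax
    rw [hsymm] at hconv
    rw [hF]
    refine le_of_mul_le_mul_left ?_ ht0
    linarith
  have hnonneg : 0 ≤ F p y := by simpa using hsegment 1 one_pos le_rfl
  by_contra! hlt
  set c := K / 2 * nrm (Φ y - p) ^ 2
  have hc : 0 < c := hnonneg.trans_lt hlt
  have hbound := hsegment ((c - F p y) / (2 * c)) (div_pos (sub_pos.2 hlt) (by positivity))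
    ((div_le_one (by positivity)).2 (by linarith))
  have hmid : (1 - (c - F p y) / (2 * c)) * c = (c + F p y) / 2 := by
    field_simp
    ring
  linarith
end

section
/- For every p ∈ 𝒵 and all y, y′ ∈ ℝ^M, the Fenchel coupling satisfies F(p,y′) ≤ F(p,y) + ⟨Φ(y) − p, y′ − y⟩ + (1/(2K))‖y′ − y‖_*², where ‖·‖_* is the dual norm of ‖·‖. -/
open scoped Matrix

/-- The dual norm ‖y‖_* = sup{⟨y,x⟩ : ‖x‖ ≤ 1} of a norm `nrm` on ℝ^M. -/
noncomputable def dualN {M : ℕ} (nrm : (Fin M → ℝ) → ℝ) (y : Fin M → ℝ) : ℝ :=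
  sSup {r : ℝ | ∃ x : Fin M → ℝ, nrm x ≤ 1 ∧ r = y ⬝ᵥ x}

/-- Every linear functional on a finite-dimensional real space is bounded with respect to any norm. -/
theorem exists_le_mul_norm_of_finiteDimensional {V : Type*} [AddCommGroup V] [Module ℝ V]
    [FiniteDimensional ℝ V] (n : V → ℝ) (h0 : ∀ x, n x = 0 ↔ x = 0)
    (hS : ∀ (c : ℝ) x, n (c • x) = |c| * n x) (hT : ∀ x y, n (x + y) ≤ n x + n y)
    (hnonneg : ∀ x, 0 ≤ n x) (f : V →ₗ[ℝ] ℝ) : ∃ C, 0 ≤ C ∧ ∀ x, f x ≤ C * n x := by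
  let _ : Norm V := ⟨n⟩
  have core : NormedSpace.Core ℝ V :=
    { norm_nonneg := hnonneg
      norm_smul := hS
      norm_triangle := hT
      norm_eq_zero_iff := h0 }
  let _ : NormedAddCommGroup V := NormedAddCommGroup.ofCore core
  let _ : NormedSpace ℝ V := NormedSpace.ofCore core
  exact ⟨‖f.toContinuousLinearMap‖, norm_nonneg _, fun x =>
    (le_abs_self _).trans (f.toContinuousLinearMap.le_opNorm x)⟩

/-- A function satisfying the homogeneity and triangle laws of a norm is nonnegative. -/
theorem nonneg_of_smul_of_add_le {V : Type*} [AddCommGroup V] [Module ℝ V] (n : V → ℝ)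
    (hS : ∀ (c : ℝ) x, n (c • x) = |c| * n x) (hT : ∀ x y, n (x + y) ≤ n x + n y) (x : V) :
    0 ≤ n x := by
  have h := hT x ((-1 : ℝ) • x)
  have h0 := hS 0 x
  rw [hS, neg_one_smul, add_neg_cancel] at h
  rw [zero_smul] at h0
  norm_num at h h0
  linarith

/-- The Hölder-type inequality for a norm and its dual norm. -/
theorem dotProduct_le_dualN_mul {M : ℕ} (nrm : (Fin M → ℝ) → ℝ)
    (hnrm0 : ∀ x, nrm x = 0 ↔ x = 0)
    (hnrmS : ∀ (c : ℝ) x, nrm (c • x) = |c| * nrm x)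
    (hnrmT : ∀ x y, nrm (x + y) ≤ nrm x + nrm y) (y x : Fin M → ℝ) :
    y ⬝ᵥ x ≤ dualN nrm y * nrm x := by
  have hnonneg := nonneg_of_smul_of_add_le nrm hnrmS hnrmT
  obtain ⟨C, hC, hbound⟩ := exists_le_mul_norm_of_finiteDimensional nrm hnrm0 hnrmS hnrmT
    hnonneg (dotProductBilin ℝ ℝ y)
  have hbdd : BddAbove {r : ℝ | ∃ x : Fin M → ℝ, nrm x ≤ 1 ∧ r = y ⬝ᵥ x} := by
    refine ⟨C, ?_⟩
    rintro r ⟨z, hz, rfl⟩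
    exact (hbound z).trans (mul_le_of_le_one_right hC hz)
  rcases eq_or_ne x 0 with rfl | hx
  · simp [(hnrm0 0).2 rfl]
  · have hpos : 0 < nrm x := (hnonneg x).lt_of_ne' fun h => hx ((hnrm0 x).1 h)
    have h : y ⬝ᵥ ((nrm x)⁻¹ • x) ≤ dualN nrm y :=
      le_csSup hbdd ⟨_, by rw [hnrmS, abs_of_pos (inv_pos.2 hpos), inv_mul_cancel₀ hpos.ne'], rfl⟩
    rwa [dotProduct_smul, smul_eq_mul, inv_mul_le_iff₀ hpos, mul_comm] at h

/-- If `d ≤ A - c (1 - t)` for every `t ∈ (0, 1]`, then the inequality also holds at `t = 0`. -/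
theorem le_sub_of_forall_le_sub_mul {d A c : ℝ} (hc : 0 ≤ c)
    (h : ∀ t : ℝ, 0 < t → t ≤ 1 → d ≤ A - c * (1 - t)) : d ≤ A - c := by
  by_contra! hlt
  have hδ : 0 < d - (A - c) := sub_pos.2 hlt
  set δ := d - (A - c) with hδ_def
  have hsum : 0 < δ + c := by linarith
  have ht := h (δ / (δ + c)) (div_pos hδ hsum) ((div_le_one hsum).2 (by linarith))
  have h1 : δ ≤ c * (δ / (δ + c)) := by linarith
  rw [← mul_div_assoc, le_div_iff₀ hsum] at h1
  nlinarith

/-- The objective `⟨y, ·⟩ - ψ` of a strongly convex `ψ` grows quadratically away from its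
maximizer. -/
theorem dotProduct_sub_le_of_isMaxOn {M : ℕ} {Z : Set (Fin M → ℝ)} (hZconv : Convex ℝ Z)
    (nrm : (Fin M → ℝ) → ℝ) {K : ℝ} (hK : 0 < K) (ψ : (Fin M → ℝ) → ℝ)
    (hψsc : ∀ x ∈ Z, ∀ y ∈ Z, ∀ t ∈ Set.Icc (0 : ℝ) 1,
      ψ (t • x + (1 - t) • y) ≤ t * ψ x + (1 - t) * ψ y - K / 2 * t * (1 - t) * nrm (x - y) ^ 2)
    {y a b : Fin M → ℝ} (ha : a ∈ Z) (hb : b ∈ Z)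
    (hmax : IsMaxOn (fun x => y ⬝ᵥ x - ψ x) Z a) :
    y ⬝ᵥ b - y ⬝ᵥ a ≤ ψ b - ψ a - K / 2 * nrm (b - a) ^ 2 := by
  refine le_sub_of_forall_le_sub_mul (by positivity) fun t ht0 ht1 => ?_
  have hx : t • b + (1 - t) • a ∈ Z := hZconv hb ha ht0.le (by linarith) (by ring)
  have h1 : y ⬝ᵥ (t • b + (1 - t) • a) - ψ (t • b + (1 - t) • a) ≤ y ⬝ᵥ a - ψ a := hmax hx
  have h2 := hψsc b hb a ha t ⟨ht0.le, ht1⟩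
  simp only [dotProduct_add, dotProduct_smul, smul_eq_mul] at h1
  refine le_of_mul_le_mul_left ?_ ht0
  linarith

/-- **Fenchel coupling one-step upper bound.**
Let 𝒵 ⊆ ℝ^M be nonempty compact convex, ‖·‖ (= `nrm`) a norm on ℝ^M, K > 0, ψ a continuous
K-strongly convex regularizer on 𝒵, Φ the induced mirror map and F the Fenchel coupling.
Then for every p ∈ 𝒵 and all y, y′ ∈ ℝ^M:
F(p,y′) ≤ F(p,y) + ⟨Φ(y) − p, y′ − y⟩ + (1/(2K))‖y′ − y‖_*². -/
theorem stmt2 {M : ℕ} (Z : Set (Fin M → ℝ)) (hZne : Z.Nonempty)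
    (hZcomp : IsCompact Z) (hZconv : Convex ℝ Z)
    (nrm : (Fin M → ℝ) → ℝ)
    (hnrm0 : ∀ x, nrm x = 0 ↔ x = 0)
    (hnrmS : ∀ (c : ℝ) x, nrm (c • x) = |c| * nrm x)
    (hnrmT : ∀ x y, nrm (x + y) ≤ nrm x + nrm y)
    (K : ℝ) (hK : 0 < K)
    (ψ : (Fin M → ℝ) → ℝ) (hψcont : ContinuousOn ψ Z)
    (hψsc : ∀ x ∈ Z, ∀ y ∈ Z, ∀ t ∈ Set.Icc (0 : ℝ) 1,
      ψ (t • x + (1 - t) • y) ≤ t * ψ x + (1 - t) * ψ y - K / 2 * t * (1 - t) * nrm (x - y) ^ 2)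
    (Φ : (Fin M → ℝ) → (Fin M → ℝ))
    (hΦmem : ∀ y, Φ y ∈ Z)
    (hΦmax : ∀ y, IsMaxOn (fun x => y ⬝ᵥ x - ψ x) Z (Φ y))
    (F : (Fin M → ℝ) → (Fin M → ℝ) → ℝ)
    (hF : ∀ p y, F p y = ψ p + (y ⬝ᵥ Φ y - ψ (Φ y)) - y ⬝ᵥ p) :
    ∀ p ∈ Z, ∀ y y' : Fin M → ℝ,
      F p y' ≤ F p y + (Φ y - p) ⬝ᵥ (y' - y) + 1 / (2 * K) * dualN nrm (y' - y) ^ 2 := by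
  intro p _ y y'
  have hgrowth := dotProduct_sub_le_of_isMaxOn hZconv nrm hK ψ hψsc (hΦmem y) (hΦmem y') (hΦmax y)
  have hdual := dotProduct_le_dualN_mul nrm hnrm0 hnrmS hnrmT (y' - y) (Φ y' - Φ y)
  have hyoung : dualN nrm (y' - y) * nrm (Φ y' - Φ y) ≤
      1 / (2 * K) * dualN nrm (y' - y) ^ 2 + K / 2 * nrm (Φ y' - Φ y) ^ 2 := by
    have hsq : 1 / (2 * K) * dualN nrm (y' - y) ^ 2 + K / 2 * nrm (Φ y' - Φ y) ^ 2 -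
        dualN nrm (y' - y) * nrm (Φ y' - Φ y) =
        1 / (2 * K) * (dualN nrm (y' - y) - K * nrm (Φ y' - Φ y)) ^ 2 := by
      field_simp
      ring
    have : 0 ≤ 1 / (2 * K) * (dualN nrm (y' - y) - K * nrm (Φ y' - Φ y)) ^ 2 := by positivity
    linarith
  rw [hF, hF, dotProduct_comm (Φ y - p)]
  simp only [dotProduct_sub, sub_dotProduct] at hdual ⊢
  linarith
end

section
/- For all t ∈ ℕ and all λ ∈ ℝ^R_{≥0}, the price iterates satisfy (1/2)(‖Λ_t − λ‖₂² − ‖Λ_0 − λ‖₂²) ≤ Σ_{τ=0}^{t−1} ζ_τ ⟨Λ_τ − λ, A X_τ − b⟩ + Σ_{τ=0}^{t−1} (2η_τ² − η_τ/2) ‖Λ_τ‖₂² + (‖λ‖₂²/2) Σ_{τ=0}^{t−1} η_τ + 2 C₃² Σ_{τ=0}^{t−1} ζ_τ². -/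
open scoped Matrix
open Finset

lemma sq_max_zero_sub_le {y l : ℝ} (hl : 0 ≤ l) : (max y 0 - l) ^ 2 ≤ (y - l) ^ 2 := by
  rcases le_total y 0 with h | h
  · rw [max_eq_right h]
    nlinarith
  · rw [max_eq_left h]

lemma half_sq_price_step_le {x g l z e : ℝ} (hl : 0 ≤ l) (he : 0 ≤ e) :
    1 / 2 * ((max ((1 - e) * x + z * g) 0 - l) ^ 2 - (x - l) ^ 2) ≤
      z * ((x - l) * g) + (2 * e ^ 2 - e / 2) * x ^ 2 + l ^ 2 / 2 * e + 2 * g ^ 2 * z ^ 2 := by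
  have h := sq_max_zero_sub_le (y := (1 - e) * x + z * g) hl
  nlinarith [mul_nonneg he (sq_nonneg (x - l)), sq_nonneg (z * g + e * x),
    sq_nonneg (z * g), sq_nonneg (e * x)]

lemma half_dotProduct_price_step_le {ι : Type*} [Fintype ι] {x y g l : ι → ℝ} {z e : ℝ}
    (hl : ∀ r, 0 ≤ l r) (he : 0 ≤ e) (hy : ∀ r, y r = max ((1 - e) * x r + z * g r) 0) :
    1 / 2 * ((y - l) ⬝ᵥ (y - l) - (x - l) ⬝ᵥ (x - l)) ≤
      z * ((x - l) ⬝ᵥ g) + (2 * e ^ 2 - e / 2) * (x ⬝ᵥ x) + (l ⬝ᵥ l) / 2 * e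
        + 2 * (g ⬝ᵥ g) * z ^ 2 := by
  simp only [dotProduct, Pi.sub_apply, ← sum_sub_distrib, mul_sum, sum_div, sum_mul,
    ← sum_add_distrib]
  refine sum_le_sum fun r _ => ?_
  simpa only [hy r, ← pow_two] using
    half_sq_price_step_le (x := x r) (g := g r) (z := z) (hl r) he

/-- **Cumulative bound for the price iterates (Lemma 2).**
With Λ_{τ+1} = [(1 − η_τ)Λ_τ + ζ_τ(A X_τ − b)]₊ and ‖Ax − b‖₂ ≤ C₃ on 𝒳, for all t ∈ ℕ and
λ ≥ 0: (1/2)(‖Λ_t − λ‖₂² − ‖Λ_0 − λ‖₂²) ≤ Σ_{τ<t} ζ_τ⟨Λ_τ − λ, AX_τ − b⟩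
  + Σ_{τ<t}(2η_τ² − η_τ/2)‖Λ_τ‖₂² + (‖λ‖₂²/2)Σ_{τ<t}η_τ + 2C₃²Σ_{τ<t}ζ_τ².
(Here ‖v‖₂² = ⟨v,v⟩.) -/
theorem stmt5 {R D : ℕ} (A : Matrix (Fin R) (Fin D) ℝ) (b : Fin R → ℝ)
    (𝒳 : Set (Fin D → ℝ)) (C₃ : ℝ) (hC₃0 : 0 ≤ C₃)
    (hC₃ : ∀ x ∈ 𝒳, Real.sqrt ((A.mulVec x - b) ⬝ᵥ (A.mulVec x - b)) ≤ C₃)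
    (X : ℕ → Fin D → ℝ) (hX : ∀ τ, X τ ∈ 𝒳)
    (Λ : ℕ → Fin R → ℝ) (hΛ0 : ∀ r, 0 ≤ Λ 0 r)
    (ζ η : ℕ → ℝ) (hζ : ∀ τ, ζ τ ∈ Set.Ioo (0 : ℝ) 1) (hη : ∀ τ, 0 ≤ η τ)
    (hΛ : ∀ τ r, Λ (τ + 1) r = max ((1 - η τ) * Λ τ r + ζ τ * (A.mulVec (X τ) - b) r) 0) :
    ∀ (t : ℕ) (lam : Fin R → ℝ), (∀ r, 0 ≤ lam r) →
      1 / 2 * ((Λ t - lam) ⬝ᵥ (Λ t - lam) - (Λ 0 - lam) ⬝ᵥ (Λ 0 - lam)) ≤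
        (∑ τ ∈ range t, ζ τ * ((Λ τ - lam) ⬝ᵥ (A.mulVec (X τ) - b)))
        + (∑ τ ∈ range t, (2 * η τ ^ 2 - η τ / 2) * (Λ τ ⬝ᵥ Λ τ))
        + (lam ⬝ᵥ lam) / 2 * (∑ τ ∈ range t, η τ)
        + 2 * C₃ ^ 2 * (∑ τ ∈ range t, ζ τ ^ 2) := by
  intro t lam hlam
  induction t with
  | zero => simp
  | succ t ih =>
    have hstep := half_dotProduct_price_step_le hlam (hη t) (hΛ t)
    have hg : (A.mulVec (X t) - b) ⬝ᵥ (A.mulVec (X t) - b) ≤ C₃ ^ 2 :=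
      (Real.sqrt_le_left hC₃0).1 (hC₃ _ (hX t))
    have hgz := mul_le_mul_of_nonneg_right hg (sq_nonneg (ζ t))
    simp only [sum_range_succ, mul_add]
    linarith
end

section
/- Let 𝒳 be a nonempty compact convex subset of ℝ^D, v : 𝒳 → ℝ^D, A ∈ ℝ^{R×D}, b ∈ ℝ^R, and 𝒬 = {x ∈ 𝒳 : A x ≤ b componentwise}. Assume Slater's condition: there exists x* in the relative interior of 𝒳 with A x* < b componentwise. Then the following are equivalent for x̄ ∈ 𝒬: (1) x̄ solves VI(𝒬, v); (2) there exists λ̄ ∈ ℝ^R_{≥0} such that (x̄, λ̄) solves VI(𝒳 × ℝ^R_{≥0}, ṽ), where ṽ(x,λ) = (v(x) − Aᵀλ, A x − b). -/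
open scoped Matrix

/-- Lagrange multipliers for a concave objective under finitely many convex constraints satisfying
Slater's condition. -/
theorem exists_lagrange_multiplier_of_slater {E ι : Type*} [AddCommGroup E] [Module ℝ E]
    [Fintype ι] {X : Set E} {φ : E → ℝ} {G : ι → E → ℝ}
    (hφ : ConcaveOn ℝ X φ) (hG : ∀ i, ConvexOn ℝ X (G i))
    (hslater : ∃ x ∈ X, ∀ i, G i x < 0)
    (hmax : ∀ x ∈ X, (∀ i, G i x ≤ 0) → φ x ≤ 0) :
    ∃ l : ι → ℝ, (∀ i, 0 ≤ l i) ∧ ∀ x ∈ X, φ x ≤ ∑ i, l i * G i x := by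
  classical
  obtain ⟨z, hz, hzG⟩ := hslater
  set C : Set (ℝ × (ι → ℝ)) := {p | ∃ x ∈ X, p.1 < φ x ∧ ∀ i, G i x < p.2 i} with hC
  have hopen : IsOpen C := by
    have : C = ⋃ x ∈ X, Set.Iio (φ x) ×ˢ Set.univ.pi fun i => Set.Ioi (G i x) := by
      ext p
      simp [hC, and_left_comm]
    rw [this]
    exact isOpen_biUnion fun x _ =>
      isOpen_Iio.prod (isOpen_set_pi Set.finite_univ fun i _ => isOpen_Ioi)
  have hconv : Convex ℝ C := by
    intro p hp q hq s t hs ht hst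
    have hp' : ∃ x ∈ X, p.1 < φ x ∧ ∀ i, G i x < p.2 i := hp
    have hq' : ∃ x ∈ X, q.1 < φ x ∧ ∀ i, G i x < q.2 i := hq
    obtain ⟨x, hx, hx1, hx2⟩ := hp'
    obtain ⟨y, hy, hy1, hy2⟩ := hq'
    have comb : ∀ a b c d : ℝ, a < b → c < d → s * a + t * c < s * b + t * d := by
      intro a b c d hab hcd
      rcases hs.eq_or_lt with rfl | hs'
      · obtain rfl : t = 1 := by linarith
        simpa using hcd
      · nlinarith [mul_lt_mul_of_pos_left hab hs', mul_le_mul_of_nonneg_left hcd.le ht]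
    refine ⟨s • x + t • y, hφ.1 hx hy hs ht hst, ?_, fun i => ?_⟩
    · exact (comb _ _ _ _ hx1 hy1).trans_le (hφ.2 hx hy hs ht hst)
    · exact ((hG i).2 hx hy hs ht hst).trans_lt (comb _ _ _ _ (hx2 i) (hy2 i))
  have h0 : (0 : ℝ × (ι → ℝ)) ∉ C := by
    rintro ⟨x, hx, hx1, hx2⟩
    exact (hmax x hx fun i => (hx2 i).le).not_gt hx1
  obtain ⟨f, hf⟩ := geometric_hahn_banach_open_point hconv hopen h0
  set a : ℝ := f (1, 0) with ha
  set g : ι → ℝ := fun i => f (0, Pi.single i 1) with hg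
  have hrep : ∀ t u, f (t, u) = t * a + ∑ i, u i * g i := by
    intro t u
    have hu : ((t, u) : ℝ × (ι → ℝ)) =
        t • ((1, 0) : ℝ × (ι → ℝ)) + ∑ i, u i • ((0, Pi.single i 1) : ℝ × (ι → ℝ)) := by
      ext j
      · simp [Prod.fst_sum]
      · simp [Prod.snd_sum, Finset.sum_apply, Pi.single_apply]
    simp only [hu, map_add, map_sum, map_smul, smul_eq_mul, ha, hg]
  have hneg : ∀ x ∈ X, ∀ (t : ℝ) (u : ι → ℝ), t < φ x → (∀ i, G i x < u i) → t * a + ∑ i, u i * g i < 0 := by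
    intro x hx t u ht hu
    have := hf (t, u) ⟨x, hx, ht, hu⟩
    rwa [hrep, map_zero] at this
  have hapos : 0 < a := by
    have := hneg z hz (min (φ z) 0 - 1) 0 (by linarith [min_le_left (φ z) 0]) hzG
    have h1 := min_le_right (φ z) 0
    simp only [Pi.zero_apply, zero_mul, Finset.sum_const_zero, add_zero] at this
    by_contra! hle
    nlinarith
  have hgle : ∀ i, g i ≤ 0 := by
    intro i
    by_contra! hi
    set K := (φ z - 1) * a with hK
    have hs : 0 ≤ (|K| + 1) / g i := by positivity
    have := hneg z hz (φ z - 1) (Pi.single i ((|K| + 1) / g i)) (by linarith) fun j =>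
      (hzG j).trans_le <| by
        rw [Pi.single_apply]
        split_ifs <;> simp [hs]
    simp only [Pi.single_apply, ite_mul, zero_mul, Finset.sum_ite_eq', Finset.mem_univ,
      if_true, div_mul_cancel₀ _ hi.ne'] at this
    linarith [neg_abs_le K]
  have hlim : ∀ x ∈ X, φ x * a + ∑ i, G i x * g i ≤ 0 := by
    intro x hx
    have hcont : Filter.Tendsto (fun ε : ℝ => (φ x - ε) * a + ∑ i, (G i x + ε) * g i)
        (nhdsWithin 0 (Set.Ioi 0)) (nhds ((φ x - 0) * a + ∑ i, (G i x + 0) * g i)) :=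
      (Continuous.tendsto (by fun_prop) 0).mono_left nhdsWithin_le_nhds
    simp only [sub_zero, add_zero] at hcont
    refine le_of_tendsto hcont ?_
    filter_upwards [self_mem_nhdsWithin] with ε hε
    have hε' : 0 < ε := hε
    exact (hneg x hx _ (fun i => G i x + ε) (by linarith) fun i => by linarith).le
  refine ⟨fun i => -g i / a, fun i => div_nonneg (neg_nonneg.2 (hgle i)) hapos.le, ?_⟩
  intro x hx
  have hsum : ∑ i, -g i / a * G i x = -(∑ i, G i x * g i) / a := by
    rw [← Finset.sum_neg_distrib, Finset.sum_div]
    exact Finset.sum_congr rfl fun i _ => by ring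
  rw [hsum, le_div_iff₀ hapos]
  linarith [hlim x hx]

/-- The pairing of the saddle-point field `(w - Aᵀ l, A y - b)` with `(x - y, m - l)`. -/
theorem dotProduct_saddle_field {m n : Type*} [Fintype m] [Fintype n]
    (A : Matrix m n ℝ) (b l k : m → ℝ) (w x y : n → ℝ) :
    (x - y) ⬝ᵥ (w - A.transpose.mulVec l) + (k - l) ⬝ᵥ (A.mulVec y - b) =
      (x - y) ⬝ᵥ w - l ⬝ᵥ (A.mulVec x - b) + k ⬝ᵥ (A.mulVec y - b) := by
  have h : (x - y) ⬝ᵥ A.transpose.mulVec l = l ⬝ᵥ A.mulVec x - l ⬝ᵥ A.mulVec y := by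
    rw [Matrix.mulVec_transpose, dotProduct_comm, ← Matrix.dotProduct_mulVec, Matrix.mulVec_sub,
      dotProduct_sub]
  simp only [dotProduct_sub, sub_dotProduct] at h ⊢
  linarith

/-- **Decoupling the coupled constraints (Proposition 2).**
Let 𝒳 ⊆ ℝ^D be nonempty compact convex, v : 𝒳 → ℝ^D, A ∈ ℝ^{R×D}, b ∈ ℝ^R,
𝒬 = {x ∈ 𝒳 : Ax ≤ b}, and assume Slater's condition: some x* in the relative interior of 𝒳
satisfies Ax* < b.  Then x̄ ∈ 𝒬 solves VI(𝒬,v) iff there is λ̄ ≥ 0 such that (x̄,λ̄) solves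
VI(𝒳 × ℝ^R_{≥0}, ṽ) with ṽ(x,λ) = (v(x) − Aᵀλ, Ax − b). -/
theorem stmt8 {D R : ℕ} (𝒳 : Set (Fin D → ℝ)) (hne : 𝒳.Nonempty)
    (hcomp : IsCompact 𝒳) (hconv : Convex ℝ 𝒳)
    (v : (Fin D → ℝ) → (Fin D → ℝ)) (A : Matrix (Fin R) (Fin D) ℝ) (b : Fin R → ℝ)
    (Q : Set (Fin D → ℝ)) (hQ : Q = {x ∈ 𝒳 | ∀ r, A.mulVec x r ≤ b r})
    (hslater : ∃ xs ∈ intrinsicInterior ℝ 𝒳, ∀ r, A.mulVec xs r < b r)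
    (xbar : Fin D → ℝ) (hxbar : xbar ∈ Q) :
    (∀ x ∈ Q, (x - xbar) ⬝ᵥ v xbar ≤ 0) ↔
      ∃ lamBar : Fin R → ℝ, (∀ r, 0 ≤ lamBar r) ∧
        ∀ x ∈ 𝒳, ∀ lam : Fin R → ℝ, (∀ r, 0 ≤ lam r) →
          (x - xbar) ⬝ᵥ (v xbar - A.transpose.mulVec lamBar)
            + (lam - lamBar) ⬝ᵥ (A.mulVec xbar - b) ≤ 0 := by
  subst hQ
  constructor
  · intro hVI
    obtain ⟨z, hz, hzb⟩ := hslater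
    obtain ⟨l, hl, hle⟩ := exists_lagrange_multiplier_of_slater (X := 𝒳)
      (φ := fun x => (x - xbar) ⬝ᵥ v xbar) (G := fun r x => A.mulVec x r - b r)
      ⟨hconv, fun x _ y _ s t _ _ hst => le_of_eq <| by
        obtain rfl : s = 1 - t := by linarith
        simp only [sub_dotProduct, add_dotProduct, smul_dotProduct, smul_eq_mul]
        ring⟩
      (fun r => ⟨hconv, fun x _ y _ s t _ _ hst => le_of_eq <| by
        obtain rfl : s = 1 - t := by linarith
        simp only [Matrix.mulVec_add, Matrix.mulVec_smul, Pi.add_apply, Pi.smul_apply, smul_eq_mul]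
        ring⟩)
      ⟨z, intrinsicInterior_subset hz, fun r => sub_neg.2 (hzb r)⟩
      (fun x hx h => hVI x ⟨hx, fun r => sub_nonpos.1 (h r)⟩)
    refine ⟨l, hl, fun x hx k hk => ?_⟩
    rw [dotProduct_saddle_field]
    have h1 : (x - xbar) ⬝ᵥ v xbar ≤ l ⬝ᵥ (A.mulVec x - b) := hle x hx
    have h2 : k ⬝ᵥ (A.mulVec xbar - b) ≤ 0 := Finset.sum_nonpos fun r _ =>
      mul_nonpos_of_nonneg_of_nonpos (hk r) (sub_nonpos.2 (hxbar.2 r))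
    linarith
  · rintro ⟨l, hl, h⟩ x ⟨hx, hxb⟩
    have h1 := h x hx 0 fun _ => le_rfl
    rw [dotProduct_saddle_field, zero_dotProduct] at h1
    have h2 : l ⬝ᵥ (A.mulVec x - b) ≤ 0 := Finset.sum_nonpos fun r _ =>
      mul_nonpos_of_nonneg_of_nonpos (hl r) (sub_nonpos.2 (hxb r))
    linarith
end

section
/- Let 𝒟 ⊆ ℝ^D be nonempty and convex, let g = (g₁,…,g_M) : 𝒟 → ℝ^M be continuously differentiable with each component g_i convex on 𝒟, let 𝒵 = {x ∈ 𝒟 : g(x) ≤ 0}, and assume Slater's constraint qualification: there exists x* in the relative interior of 𝒟 with g(x*) < 0 componentwise. Let F : 𝒵 → ℝ^D. Then x̄ solves VI(𝒵, F) if and only if x̄ ∈ 𝒟, g(x̄) ≤ 0, and there exists λ̄ ∈ ℝ^M_{≥0} with ⟨λ̄, g(x̄)⟩ = 0 such that ⟨x − x̄, F(x̄) − Σ_{i=1}^M λ̄_i ∇g_i(x̄)⟩ ≤ 0 for all x ∈ 𝒟. -/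
open scoped Matrix

/-- **Convex Lagrange multipliers** under Slater's condition: if a convex function `φ` is
nonnegative wherever the convex constraints `g i` are all negative, then some nonnegative
combination of the constraints makes `φ + ∑ i, c i * g i` nonnegative on the whole domain. -/
theorem ConvexOn.exists_lagrange_multiplier {E ι : Type*} [AddCommGroup E] [Module ℝ E]
    [Fintype ι] {s : Set E} {φ : E → ℝ} {g : ι → E → ℝ} (hφ : ConvexOn ℝ s φ)
    (hg : ∀ i, ConvexOn ℝ s (g i)) (hslater : ∃ x ∈ s, ∀ i, g i x < 0)
    (h : ∀ x ∈ s, (∀ i, g i x < 0) → 0 ≤ φ x) :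
    ∃ c : ι → ℝ, (∀ i, 0 ≤ c i) ∧ ∀ x ∈ s, 0 ≤ φ x + ∑ i, c i * g i x := by
  classical
  let A : Set ((ι → ℝ) × ℝ) := {p | ∃ x ∈ s, (∀ i, g i x < p.1 i) ∧ φ x < p.2}
  have hAopen : IsOpen A := by
    have hA : A = ⋃ x ∈ s, (Set.univ.pi fun i => Set.Ioi (g i x)) ×ˢ Set.Ioi (φ x) := by
      ext p
      simp [A, and_left_comm]
    rw [hA]
    exact isOpen_biUnion fun x _ =>
      (isOpen_set_pi Set.finite_univ fun i _ => isOpen_Ioi).prod isOpen_Ioi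
  have hAconv : Convex ℝ A := by
    rintro p ⟨x, hx, hxg, hxφ⟩ q ⟨y, hy, hyg, hyφ⟩ a b ha hb hab
    have key : ∀ {u v u' v' : ℝ}, u < u' → v < v' → a * u + b * v < a * u' + b * v' := by
      intro u v u' v' hu hv
      rcases ha.eq_or_lt with rfl | ha
      · obtain rfl : b = 1 := by linarith
        linarith
      · nlinarith [mul_lt_mul_of_pos_left hu ha, mul_le_mul_of_nonneg_left hv.le hb]
    exact ⟨a • x + b • y, hφ.1 hx hy ha hb hab,
      fun i => ((hg i).2 hx hy ha hb hab).trans_lt (key (hxg i) (hyg i)),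
      (hφ.2 hx hy ha hb hab).trans_lt (key hxφ hyφ)⟩
  have h0 : (0 : (ι → ℝ) × ℝ) ∉ A := fun ⟨x, hx, hxg, hxφ⟩ => (h x hx hxg).not_gt hxφ
  obtain ⟨f, hf⟩ := geometric_hahn_banach_open_point hAconv hAopen h0
  rw [map_zero] at hf
  have hfapp : ∀ (u : ι → ℝ) (r : ℝ),
      f (u, r) = ∑ i, u i * f (Pi.single i 1, 0) + r * f (0, 1) := by
    intro u r
    have hu : (u, r) = ∑ i, u i • ((Pi.single i 1, 0) : (ι → ℝ) × ℝ)
        + r • ((0, 1) : (ι → ℝ) × ℝ) := by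
      ext j
      · simp [Prod.fst_sum, Finset.sum_apply, Pi.single_apply]
      · simp [Prod.snd_sum]
    conv_lhs => rw [hu]
    simp only [map_add, map_sum, map_smul, smul_eq_mul]
  obtain ⟨z, hz, hzg⟩ := hslater
  have hr : 0 < |φ z| + 1 := by positivity
  have hzA : ∀ u : ι → ℝ, (∀ i, 0 ≤ u i) → f (u, |φ z| + 1) < 0 := fun u hu =>
    hf _ ⟨z, hz, fun i => (hzg i).trans_le (hu i), by
      simpa using (le_abs_self (φ z)).trans_lt (lt_add_one _)⟩
  have hν : f (0, 1) < 0 := by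
    have := hzA 0 fun _ => le_rfl
    rw [hfapp] at this
    simp only [Pi.zero_apply, zero_mul, Finset.sum_const_zero, zero_add] at this
    exact neg_of_mul_neg_right this hr.le
  have hνi : ∀ i, f (Pi.single i 1, 0) ≤ 0 := by
    intro i
    by_contra! hi
    set t := -((|φ z| + 1) * f (0, 1)) / f (Pi.single i 1, 0) with ht
    have htpos : 0 ≤ t := div_nonneg (by nlinarith) hi.le
    have := hzA (Pi.single i t) fun j => by
      by_cases hj : j = i
      · subst hj; simpa
      · simp [hj]
    rw [hfapp, Finset.sum_eq_single i (fun j _ hj => by simp [hj]) (by simp),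
      Pi.single_eq_same, ht, div_mul_cancel₀ _ hi.ne'] at this
    linarith
  refine ⟨fun i => f (Pi.single i 1, 0) / f (0, 1), fun i => div_nonneg_of_nonpos (hνi i) hν.le,
    fun x hx => ?_⟩
  have hle : f (fun i => g i x, φ x) ≤ 0 := by
    refine le_of_forall_pos_le_add fun ε hε => ?_
    have hc : 0 < |f (fun _ => 1, 1)| + 1 := by positivity
    have hδ : 0 < ε / (|f (fun _ => 1, 1)| + 1) := div_pos hε hc
    set δ := ε / (|f (fun _ => 1, 1)| + 1) with hδdef
    have hlt := hf ((fun i => g i x, φ x) + δ • ((fun _ => 1, 1) : (ι → ℝ) × ℝ))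
      ⟨x, hx, fun i => by simpa using hδ, by simpa using hδ⟩
    rw [map_add, map_smul, smul_eq_mul] at hlt
    have hmul : δ * (|f (fun _ => 1, 1)| + 1) = ε := div_mul_cancel₀ _ hc.ne'
    nlinarith [neg_abs_le (f (fun _ => 1, 1))]
  rw [hfapp] at hle
  have hsum : φ x + ∑ i, f (Pi.single i 1, 0) / f (0, 1) * g i x
      = (∑ i, g i x * f (Pi.single i 1, 0) + φ x * f (0, 1)) / f (0, 1) := by
    rw [add_div, mul_div_cancel_right₀ _ hν.ne, Finset.sum_div, add_comm]
    congr 1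
    exact Finset.sum_congr rfl fun i _ => by ring
  rw [hsum]
  exact div_nonneg_of_nonpos hle hν.le

/-- A differentiable convex function lies above its tangent affine functions. -/
theorem ConvexOn.fderiv_sub_le {E : Type*} [NormedAddCommGroup E] [NormedSpace ℝ E]
    {s : Set E} {f : E → ℝ} (hf : ConvexOn ℝ s f) {x y : E} (hx : x ∈ s) (hy : y ∈ s)
    (hd : DifferentiableAt ℝ f x) : fderiv ℝ f x (y - x) ≤ f y - f x := by
  have hmin : IsMinOn (fun t : ℝ => f x + t * (f y - f x) - f (x + t • (y - x)))
      (Set.Icc 0 1) 0 := by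
    intro t ht
    have := hf.2 hx hy (sub_nonneg.2 ht.2) ht.1 (by ring)
    rw [show (1 - t) • x + t • y = x + t • (y - x) by module] at this
    simp only [smul_eq_mul] at this
    simp only [Set.mem_ofPred_eq, zero_mul, zero_smul, add_zero, sub_self]
    linarith
  have hline : HasDerivAt (fun t : ℝ => x + t • (y - x)) (y - x) 0 := by
    simpa using ((hasDerivAt_id (0 : ℝ)).smul_const (y - x)).const_add x
  have hcomp : HasDerivAt (fun t : ℝ => f (x + t • (y - x))) (fderiv ℝ f x (y - x)) 0 := by
    refine HasFDerivAt.comp_hasDerivAt (l := f) 0 ?_ hline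
    simpa using hd.hasFDerivAt
  have hder := (((hasDerivAt_id (0 : ℝ)).mul_const (f y - f x)).const_add (f x)).sub hcomp
  have := hmin.localize.hasFDerivWithinAt_nonneg hder.hasFDerivAt.hasFDerivWithinAt
    (y := 1) (mem_posTangentConeAt_of_segment_subset (by
      rw [zero_add, segment_eq_Icc zero_le_one]))
  simpa using this

/-- **KKT system for variational inequalities (Proposition 5).**
Let 𝒟 ⊆ ℝ^D be nonempty convex, g = (g₁,…,g_M) : ℝ^D → ℝ^M continuously differentiable with
each gᵢ convex on 𝒟, 𝒵 = {x ∈ 𝒟 : g(x) ≤ 0}, and assume Slater's CQ: some x* in the relative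
interior of 𝒟 has g(x*) < 0.  Then x̄ solves VI(𝒵,F) iff x̄ ∈ 𝒟, g(x̄) ≤ 0 and there is
λ̄ ≥ 0 with ⟨λ̄, g(x̄)⟩ = 0 and ⟨x − x̄, F(x̄) − Σᵢ λ̄ᵢ ∇gᵢ(x̄)⟩ ≤ 0 for all x ∈ 𝒟
(the gradient term is expressed via the Fréchet derivative: ⟨x − x̄, ∇gᵢ(x̄)⟩ = Dgᵢ(x̄)[x − x̄]). -/
theorem stmt9 {D M : ℕ} (𝒟 : Set (Fin D → ℝ)) (hne : 𝒟.Nonempty) (hconv : Convex ℝ 𝒟)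
    (g : (Fin D → ℝ) → (Fin M → ℝ))
    (hg : ∀ i, ContDiff ℝ 1 (fun y => g y i))
    (hgconv : ∀ i, ConvexOn ℝ 𝒟 (fun y => g y i))
    (𝒵 : Set (Fin D → ℝ)) (h𝒵 : 𝒵 = {x ∈ 𝒟 | ∀ i, g x i ≤ 0})
    (hslater : ∃ xs ∈ intrinsicInterior ℝ 𝒟, ∀ i, g xs i < 0)
    (F : (Fin D → ℝ) → (Fin D → ℝ)) (xbar : Fin D → ℝ) :
    (xbar ∈ 𝒵 ∧ ∀ x ∈ 𝒵, (x - xbar) ⬝ᵥ F xbar ≤ 0) ↔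
      (xbar ∈ 𝒟 ∧ (∀ i, g xbar i ≤ 0) ∧
        ∃ lamBar : Fin M → ℝ, (∀ i, 0 ≤ lamBar i) ∧ lamBar ⬝ᵥ g xbar = 0 ∧
          ∀ x ∈ 𝒟, (x - xbar) ⬝ᵥ F xbar
              - ∑ i, lamBar i * fderiv ℝ (fun y => g y i) xbar (x - xbar) ≤ 0) := by
  subst h𝒵
  have hd : ∀ i, DifferentiableAt ℝ (fun y => g y i) xbar := fun i =>
    ((hg i).differentiable one_ne_zero).differentiableAt
  constructor
  · rintro ⟨⟨hxbar, hgx⟩, hvi⟩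
    refine ⟨hxbar, hgx, ?_⟩
    have hφ : ConvexOn ℝ 𝒟 fun x => -((x - xbar) ⬝ᵥ F xbar) := by
      refine ⟨hconv, fun x _ y _ a b _ _ hab => le_of_eq ?_⟩
      obtain rfl : b = 1 - a := by linarith
      simp only [sub_dotProduct, add_dotProduct, smul_dotProduct, smul_eq_mul]
      ring
    obtain ⟨xs, hxs, hgs⟩ := hslater
    obtain ⟨c, hc, hL⟩ := hφ.exists_lagrange_multiplier hgconv
      ⟨xs, intrinsicInterior_subset hxs, hgs⟩
      fun x hx hgx => neg_nonneg.2 (hvi x ⟨hx, fun i => (hgx i).le⟩)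
    have hcomp : ∑ i, c i * g xbar i = 0 := by
      refine le_antisymm (Finset.sum_nonpos fun i _ =>
        mul_nonpos_of_nonneg_of_nonpos (hc i) (hgx i)) ?_
      simpa using hL xbar hxbar
    refine ⟨c, hc, hcomp, fun x hx => ?_⟩
    have hmin : IsMinOn (fun x => -((x - xbar) ⬝ᵥ F xbar) + ∑ i, c i * g x i) 𝒟 xbar := by
      intro y hy
      simpa [hcomp] using hL y hy
    let ℓ : (Fin D → ℝ) →L[ℝ] ℝ := LinearMap.toContinuousLinearMap
      { toFun := fun x => x ⬝ᵥ F xbar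
        map_add' := fun x y => add_dotProduct x y _
        map_smul' := fun a x => smul_dotProduct a x _ }
    have hℓ : HasFDerivAt (fun x : Fin D → ℝ => (x - xbar) ⬝ᵥ F xbar) ℓ xbar := by
      simpa [sub_dotProduct, ℓ] using (ℓ.hasFDerivAt (x := xbar)).sub_const (ℓ xbar)
    have hder := hℓ.neg.add (HasFDerivAt.fun_sum (u := Finset.univ)
      fun i _ => (hd i).hasFDerivAt.const_mul (c i))
    have := hmin.localize.hasFDerivWithinAt_nonneg hder.hasFDerivWithinAt
      (y := x - xbar) (mem_posTangentConeAt_of_segment_subset (by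
        rw [add_sub_cancel]; exact hconv.segment_subset hxbar hx))
    have hℓx : ℓ (x - xbar) = (x - xbar) ⬝ᵥ F xbar := rfl
    simp only [add_apply, neg_apply,
      sum_apply, smul_apply, smul_eq_mul, hℓx] at this
    linarith
  · rintro ⟨hxbar, hgx, c, hc, hcomp, hL⟩
    refine ⟨⟨hxbar, hgx⟩, fun x ⟨hx, hgx'⟩ => (sub_nonpos.1 (hL x hx)).trans ?_⟩
    calc ∑ i, c i * fderiv ℝ (fun y => g y i) xbar (x - xbar)
        ≤ ∑ i, c i * (g x i - g xbar i) := Finset.sum_le_sum fun i _ =>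
          mul_le_mul_of_nonneg_left ((hgconv i).fderiv_sub_le hxbar hx (hd i)) (hc i)
      _ = ∑ i, c i * g x i - c ⬝ᵥ g xbar := by
          simp only [mul_sub, Finset.sum_sub_distrib, dotProduct]
      _ ≤ 0 := by
          rw [hcomp, sub_zero]
          exact Finset.sum_nonpos fun i _ => mul_nonpos_of_nonneg_of_nonpos (hc i) (hgx' i)
end
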